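/- Suppose (X_A, σ_A) and (X_B, σ_B) are continuously orbit equivalent via h with functions k_1, l_1 : X_A → ℤ_{≥0} and k_2, l_2 : X_B → ℤ_{≥0}, and set c_1 = l_1 − k_1 on X_A and c_2 = l_2 − k_2 on X_B. Then the ordinary zeta functions satisfy ζ_A(t) = ζ_{B,c_2}(s) and ζ_B(t) = ζ_{A,c_1}(s) for t = e^{−s}, i.e., exp(Σ_{n=1}^∞ (1/n)|Per_n(X_A)| e^{−sn}) = ζ_{B,c_2}(s) and exp(Σ_{n=1}^∞ (1/n)|Per_n(X_B)| e^{−sn}) = ζ_{A,c_1}(s), for s with sufficiently large real part. -/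

import Mathlib

open scoped BigOperators NNReal

namespace OneSidedMarkov

variable {N M : ℕ}

/-- The matrix has entries in `{0, 1}`. -/
def IsZeroOne (A : Matrix (Fin N) (Fin N) ℤ) : Prop := ∀ i j, A i j = 0 ∨ A i j = 1

/-- The matrix is irreducible. -/
def IsIrreducible (A : Matrix (Fin N) (Fin N) ℤ) : Prop :=
  ∀ i j, ∃ m : ℕ, 0 < m ∧ (A ^ m) i j ≠ 0

/-- The matrix is a permutation matrix. -/
def IsPermutationMatrix (A : Matrix (Fin N) (Fin N) ℤ) : Prop :=
  ∃ e : Equiv.Perm (Fin N), ∀ i j, A i j = if e i = j then 1 else 0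

/-- The one-sided topological Markov shift space `X_A`. -/
abbrev Space (A : Matrix (Fin N) (Fin N) ℤ) : Type :=
  {x : ℕ → Fin N // ∀ n, A (x n) (x (n + 1)) = 1}

/-- The shift map `σ_A`. -/
def shift (A : Matrix (Fin N) (Fin N) ℤ) (x : Space A) : Space A :=
  ⟨fun n => x.1 (n + 1), fun n => x.2 (n + 1)⟩

lemma continuous_shift (A : Matrix (Fin N) (Fin N) ℤ) : Continuous (shift A) := by
  apply Continuous.subtype_mk
  exact continuous_pi fun n => (continuous_apply (n + 1)).comp continuous_subtype_val

/-- The shift map as a continuous map. -/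
def shiftMap (A : Matrix (Fin N) (Fin N) ℤ) : C(Space A, Space A) :=
  ⟨shift A, continuous_shift A⟩

/-- The coboundary subgroup `{ g - g ∘ σ_A }` of `C(X_A, ℤ)`. -/
def cobdySubgroup (A : Matrix (Fin N) (Fin N) ℤ) : AddSubgroup C(Space A, ℤ) :=
  AddSubgroup.closure {f | ∃ g : C(Space A, ℤ), f = g - g.comp (shiftMap A)}

/-- The ordered cohomology group `H^A = C(X_A, ℤ)/{g - g∘σ_A}`. -/
abbrev Coh (A : Matrix (Fin N) (Fin N) ℤ) : Type :=
  C(Space A, ℤ) ⧸ cobdySubgroup A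

/-- The class `[f] ∈ H^A`. -/
def cohClass (A : Matrix (Fin N) (Fin N) ℤ) (f : C(Space A, ℤ)) : Coh A :=
  QuotientAddGroup.mk f

/-- The positive cone `H^A_+`. -/
def CohPos (A : Matrix (Fin N) (Fin N) ℤ) : Set (Coh A) :=
  {c | ∃ f : C(Space A, ℤ), (∀ x, 0 ≤ f x) ∧ c = cohClass A f}

/-- `u` is an order unit of `(H^A, H^A_+)`. -/
def IsOrderUnit (A : Matrix (Fin N) (Fin N) ℤ) (u : Coh A) : Prop :=
  u ∈ CohPos A ∧ ∀ g : Coh A, ∃ n : ℕ, 0 < n ∧ n • u - g ∈ CohPos A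

/-- The data `(l, k, b)` of a suspension. -/
structure SuspData (A : Matrix (Fin N) (Fin N) ℤ) where
  l : C(Space A, ℝ)
  k : C(Space A, ℝ)
  b : C(Space A, ℝ)

/-- `c = l - k`. -/
def cFun {A : Matrix (Fin N) (Fin N) ℤ} (T : SuspData A) (x : Space A) : ℝ :=
  T.l x - T.k x

/-- `(l, k, b)` is a suspension triplet for `(X_A, σ_A)`. -/
def IsSuspTriplet {A : Matrix (Fin N) (Fin N) ℤ} (T : SuspData A) : Prop :=
  (∀ x, 0 ≤ T.l x) ∧ (∀ x, 0 ≤ T.k x) ∧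
  (∃ c : C(Space A, ℤ), (∀ x, (c x : ℝ) = cFun T x) ∧ IsOrderUnit A (cohClass A c)) ∧
  (∀ x, ∃ m : ℕ, T.l x - T.b x = m) ∧
  (∀ x, ∃ m : ℕ, T.k x - T.b (shift A x) = m)

/-- The space `X_{A,b}^ℝ = {(x, r) : r ≥ b(x)}`. -/
abbrev BaseSpace {A : Matrix (Fin N) (Fin N) ℤ} (T : SuspData A) : Type :=
  {p : Space A × ℝ // T.b p.1 ≤ p.2}

/-- The elementary relation `(x, r) ∼ (σ_A(x), r - c(x))` for `r ≥ l(x)`. -/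
def SuspRel {A : Matrix (Fin N) (Fin N) ℤ} (T : SuspData A)
    (p q : BaseSpace T) : Prop :=
  T.l p.1.1 ≤ p.1.2 ∧ q.1 = (shift A p.1.1, p.1.2 - cFun T p.1.1)

/-- The equivalence relation `∼_{l,k}` generated by `SuspRel`. -/
def suspSetoid {A : Matrix (Fin N) (Fin N) ℤ} (T : SuspData A) : Setoid (BaseSpace T) :=
  ⟨Relation.EqvGen (SuspRel T), Relation.EqvGen.is_equivalence _⟩

/-- The one-sided suspension `S_{A,b}^{l,k}` with the quotient topology. -/
abbrev Susp {A : Matrix (Fin N) (Fin N) ℤ} (T : SuspData A) : Type :=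
  Quotient (suspSetoid T)

/-- The class `[x, r]`. -/
def mkSusp {A : Matrix (Fin N) (Fin N) ℤ} (T : SuspData A) (p : BaseSpace T) : Susp T :=
  Quotient.mk (suspSetoid T) p

/-- The base map `x ↦ [x, b(x)]`. -/
def basePoint {A : Matrix (Fin N) (Fin N) ℤ} (T : SuspData A) (x : Space A) : Susp T :=
  mkSusp T ⟨(x, T.b x), le_refl _⟩

/-- Translation by `t ≥ 0` on `X_{A,b}^ℝ`. -/
def shiftPt {A : Matrix (Fin N) (Fin N) ℤ} (T : SuspData A) (t : ℝ≥0)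
    (p : BaseSpace T) : BaseSpace T :=
  ⟨(p.1.1, p.1.2 + t), le_trans p.2 (le_add_of_nonneg_right t.2)⟩

lemma suspRel_shiftPt {A : Matrix (Fin N) (Fin N) ℤ} (T : SuspData A) (t : ℝ≥0)
    {p q : BaseSpace T} (h : SuspRel T p q) : SuspRel T (shiftPt T t p) (shiftPt T t q) := by
  obtain ⟨h1, h2⟩ := h
  refine ⟨le_trans h1 (le_add_of_nonneg_right t.2), ?_⟩
  show (q.1.1, q.1.2 + (t : ℝ)) = _
  rw [h2]
  show (shift A p.1.1, p.1.2 - cFun T p.1.1 + (t : ℝ))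
      = (shift A p.1.1, p.1.2 + (t : ℝ) - cFun T p.1.1)
  congr 1
  ring

lemma eqvGen_map {α : Type*} {r r' : α → α → Prop} (f : α → α)
    (hf : ∀ a b, r a b → r' (f a) (f b)) :
    ∀ a b, Relation.EqvGen r a b → Relation.EqvGen r' (f a) (f b) := by
  intro a b h
  induction h with
  | rel a b hab => exact Relation.EqvGen.rel _ _ (hf a b hab)
  | refl a => exact Relation.EqvGen.refl _
  | symm a b _ ih => exact Relation.EqvGen.symm _ _ ih
  | trans a b c _ _ ih1 ih2 => exact Relation.EqvGen.trans _ _ _ ih1 ih2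

/-- The flow `φ_{A,t}([x, r]) = [x, r + t]`, `t ∈ ℝ_+`, on the one-sided suspension. -/
def flow {A : Matrix (Fin N) (Fin N) ℤ} (T : SuspData A) (t : ℝ≥0) :
    Susp T → Susp T :=
  Quotient.map' (shiftPt T t)
    (fun p q h => eqvGen_map (shiftPt T t) (fun _ _ hr => suspRel_shiftPt T t hr) p q h)

/-- The standard suspension data `(1, 0, 0)`. -/
def stdData (A : Matrix (Fin N) (Fin N) ℤ) : SuspData A := ⟨1, 0, 0⟩

/-- The standard one-sided suspension `S_A^1`. -/
abbrev StdSusp (A : Matrix (Fin N) (Fin N) ℤ) : Type := Susp (stdData A)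

/-- The standard base map `s_A(x) = [x, 0]`. -/
def stdBase (A : Matrix (Fin N) (Fin N) ℤ) : Space A → StdSusp A :=
  basePoint (stdData A)

/-- The orbit equations of a continuous orbit equivalence. -/
def OrbitEqFns (A : Matrix (Fin N) (Fin N) ℤ) (B : Matrix (Fin M) (Fin M) ℤ)
    (h : Space A ≃ₜ Space B) (k1 l1 : C(Space A, ℕ)) (k2 l2 : C(Space B, ℕ)) : Prop :=
  (∀ x : Space A, (shift B)^[k1 x] (h (shift A x)) = (shift B)^[l1 x] (h x)) ∧
  (∀ y : Space B, (shift A)^[k2 y] (h.symm (shift B y)) = (shift A)^[l2 y] (h.symm y))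

/-- `(X_A, σ_A)` and `(X_B, σ_B)` are continuously orbit equivalent. -/
def ContOrbitEquiv (A : Matrix (Fin N) (Fin N) ℤ) (B : Matrix (Fin M) (Fin M) ℤ) : Prop :=
  ∃ h : Space A ≃ₜ Space B, ∃ k1 l1 : C(Space A, ℕ), ∃ k2 l2 : C(Space B, ℕ),
    OrbitEqFns A B h k1 l1 k2 l2

/-- One-sided flow equivalence via the homeomorphism `h`. -/
def FlowEquivVia (A : Matrix (Fin N) (Fin N) ℤ) (B : Matrix (Fin M) (Fin M) ℤ)
    (h : Space A ≃ₜ Space B) : Prop :=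
  ∃ T₁ : SuspData A, IsSuspTriplet T₁ ∧ ∃ T₂ : SuspData B, IsSuspTriplet T₂ ∧
  ∃ Φ₁ : Susp T₁ → StdSusp B, Continuous Φ₁ ∧
  ∃ Φ₂ : Susp T₂ → StdSusp A, Continuous Φ₂ ∧
  (∀ (t : ℝ≥0) (p : Susp T₁), Φ₁ (flow T₁ t p) = flow (stdData B) t (Φ₁ p)) ∧
  (∀ x : Space A, Φ₁ (basePoint T₁ x) = stdBase B (h x)) ∧
  (∀ (t : ℝ≥0) (q : Susp T₂), Φ₂ (flow T₂ t q) = flow (stdData A) t (Φ₂ q)) ∧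
  (∀ y : Space B, Φ₂ (basePoint T₂ y) = stdBase A (h.symm y))

/-- `(X_A, σ_A)` and `(X_B, σ_B)` are one-sided flow equivalent. -/
def OneSidedFlowEquiv (A : Matrix (Fin N) (Fin N) ℤ) (B : Matrix (Fin M) (Fin M) ℤ) : Prop :=
  ∃ h : Space A ≃ₜ Space B, FlowEquivVia A B h

/-- `f^m(x) = Σ_{i<m} f(σ_A^i(x))` for integer-valued `f`. -/
def birk (A : Matrix (Fin N) (Fin N) ℤ) (f : Space A → ℤ) (m : ℕ) (x : Space A) : ℤ :=
  ∑ i ∈ Finset.range m, f ((shift A)^[i] x)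

/-- `f^m(x) = Σ_{i<m} f(σ_A^i(x))` for real-valued `f`. -/
def birkR (A : Matrix (Fin N) (Fin N) ℤ) (f : Space A → ℝ) (m : ℕ) (x : Space A) : ℝ :=
  ∑ i ∈ Finset.range m, f ((shift A)^[i] x)

/-- `f^m(x) = Σ_{i<m} f(σ_A^i(x))` for ℕ-valued `f`. -/
def birkN (A : Matrix (Fin N) (Fin N) ℤ) (f : Space A → ℕ) (m : ℕ) (x : Space A) : ℕ :=
  ∑ i ∈ Finset.range m, f ((shift A)^[i] x)

/-- The map `Ψ_h` associated with a continuous orbit equivalence. -/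
def psi (A : Matrix (Fin N) (Fin N) ℤ) (B : Matrix (Fin M) (Fin M) ℤ)
    (h : Space A → Space B) (l1 k1 : Space A → ℕ) (f : Space B → ℤ) :
    Space A → ℤ :=
  fun x => (∑ i ∈ Finset.range (l1 x), f ((shift B)^[i] (h x)))
    - ∑ j ∈ Finset.range (k1 x), f ((shift B)^[j] (h (shift A x)))

/-- The dynamical zeta function `ζ_{A,f}(s)` with potential `f`. -/
noncomputable def zeta (A : Matrix (Fin N) (Fin N) ℤ) (f : Space A → ℤ) (s : ℂ) : ℂ :=
  Complex.exp (∑' n : ℕ, (1 / (n + 1 : ℂ)) *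
    ∑' x : {x : Space A // (shift A)^[n + 1] x = x},
      Complex.exp (-s * ((birk A f (n + 1) x.1 : ℤ) : ℂ)))

/-- `γ` is a periodic orbit of `(X_A, σ_A)`. -/
def IsPerOrbit (A : Matrix (Fin N) (Fin N) ℤ) (γ : Set (Space A)) : Prop :=
  ∃ (x : Space A) (p : ℕ), 0 < p ∧ (shift A)^[p] x = x ∧
    (∀ q : ℕ, 0 < q → (shift A)^[q] x = x → p ≤ q) ∧
    γ = {y | ∃ i : ℕ, i < p ∧ y = (shift A)^[i] x}

/-- `τ` is a primitive periodic orbit of the flow on the one-sided suspension. -/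
def IsFlowOrbit {A : Matrix (Fin N) (Fin N) ℤ} (T : SuspData A) (τ : Set (Susp T)) : Prop :=
  ∃ u : Susp T, (∃ t : ℝ≥0, 0 < t ∧ flow T t u = u) ∧
    τ = Set.range (fun t : ℝ≥0 => flow T t u)

/-- `ℓ(u) = min { t > 0 : φ_{A,t}(u) = u }`. -/
noncomputable def pointLen {A : Matrix (Fin N) (Fin N) ℤ} (T : SuspData A) (u : Susp T) : ℝ≥0 :=
  sInf {t : ℝ≥0 | 0 < t ∧ flow T t u = u}

/-- `ℓ(τ) = min { t > 0 : φ_{A,t}(u) = u for all u ∈ τ }`. -/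
noncomputable def orbitLen {A : Matrix (Fin N) (Fin N) ℤ} (T : SuspData A)
    (τ : Set (Susp T)) : ℝ≥0 :=
  sInf {t : ℝ≥0 | 0 < t ∧ ∀ u ∈ τ, flow T t u = u}

/-- The ordinary zeta function written with `t = e^{-s}`. -/
noncomputable def zetaOrd {N : ℕ} (A : Matrix (Fin N) (Fin N) ℤ) (s : ℂ) : ℂ :=
  Complex.exp (∑' n : ℕ, (1 / (n + 1 : ℂ)) *
    (Nat.card {x : Space A // (shift A)^[n + 1] x = x} : ℂ) *
    Complex.exp (-s * ((n : ℂ) + 1)))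

section TailEquivalence

open Function

variable {α β : Type*}

/-- Two points are tail equivalent under `f` if their forward orbits eventually meet. -/
def TailEquiv (f : α → α) (x y : α) : Prop := ∃ a b : ℕ, f^[a] x = f^[b] y

lemma TailEquiv.symm {f : α → α} {x y : α} (hxy : TailEquiv f x y) : TailEquiv f y x := by
  obtain ⟨a, b, hab⟩ := hxy
  exact ⟨b, a, hab.symm⟩

lemma TailEquiv.trans {f : α → α} {x y z : α} (hxy : TailEquiv f x y) (hyz : TailEquiv f y z) :
    TailEquiv f x z := by
  obtain ⟨a, b, hab⟩ := hxy
  obtain ⟨c, d, hcd⟩ := hyz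
  refine ⟨c + a, b + d, ?_⟩
  rw [iterate_add_apply, hab, ← iterate_add_apply, add_comm c b, iterate_add_apply, hcd,
    ← iterate_add_apply]

/-- Tail equivalence as a setoid. -/
def tailSetoid (f : α → α) : Setoid α :=
  ⟨TailEquiv f, fun _ => ⟨0, 0, rfl⟩, TailEquiv.symm, TailEquiv.trans⟩

lemma tailEquiv_iterate (f : α → α) (n : ℕ) (x : α) : TailEquiv f (f^[n] x) x := ⟨0, n, rfl⟩

/-- A point tail equivalent to a periodic point reaches its orbit. -/
lemma TailEquiv.exists_lt_iterate_eq {f : α → α} {x y : α} (hx : x ∈ periodicPts f)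
    (hy : y ∈ periodicPts f) (hxy : TailEquiv f x y) :
    ∃ i < minimalPeriod f x, f^[i] x = y := by
  obtain ⟨a, b, hab⟩ := hxy
  have hq := minimalPeriod_pos_of_mem_periodicPts hy
  have hb : b ≤ minimalPeriod f y * b := Nat.le_mul_of_pos_left b hq
  refine ⟨(minimalPeriod f y * b - b + a) % minimalPeriod f x,
    Nat.mod_lt _ (minimalPeriod_pos_of_mem_periodicPts hx), ?_⟩
  rw [iterate_mod_minimalPeriod_eq, iterate_add_apply, hab, ← iterate_add_apply,
    Nat.sub_add_cancel hb]
  exact ((isPeriodicPt_minimalPeriod f y).mul_const b).eq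

lemma TailEquiv.minimalPeriod_eq {f : α → α} {x y : α} (hx : x ∈ periodicPts f)
    (hy : y ∈ periodicPts f) (hxy : TailEquiv f x y) :
    minimalPeriod f x = minimalPeriod f y := by
  obtain ⟨i, -, rfl⟩ := hxy.exists_lt_iterate_eq hx hy
  exact (minimalPeriod_apply_iterate hx i).symm

lemma minimalPeriod_dvd_of_iterate_eq {f : α → α} {x : α} (hx : x ∈ periodicPts f) {a b : ℕ}
    (hab : f^[a] x = f^[b] x) : (minimalPeriod f x : ℤ) ∣ (a : ℤ) - b := by
  have hp := minimalPeriod_pos_of_mem_periodicPts hx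
  rw [← iterate_mod_minimalPeriod_eq (n := a), ← iterate_mod_minimalPeriod_eq (n := b),
    iterate_eq_iterate_iff_of_lt_minimalPeriod (Nat.mod_lt _ hp) (Nat.mod_lt _ hp)] at hab
  exact (Nat.modEq_iff_dvd.1 (show b ≡ a [MOD minimalPeriod f x] from hab.symm))

/-- If a point tail equivalent to the periodic point `x` is identified with itself at times
`a` and `b`, then the period of `x` divides `a - b`. -/
lemma TailEquiv.minimalPeriod_dvd {f : α → α} {x v : α} (hx : x ∈ periodicPts f)
    (hvx : TailEquiv f v x) {a b : ℕ} (hab : f^[a] v = f^[b] v) :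
    (minimalPeriod f x : ℤ) ∣ (a : ℤ) - b := by
  obtain ⟨r, t, hrt⟩ := hvx
  have h1 : f^[a + t] x = f^[b + t] x := by
    rw [iterate_add_apply, iterate_add_apply, ← hrt, ← iterate_add_apply, ← iterate_add_apply,
      add_comm a, add_comm b, iterate_add_apply, iterate_add_apply, hab]
  have h2 := minimalPeriod_dvd_of_iterate_eq hx h1
  push_cast at h2
  rwa [add_sub_add_right_eq_sub] at h2

section Cocycle

variable {f : α → α} {g : β → β} {h : α → β} {k l : α → ℕ}

/-- Iterating the orbit equation. -/
lemma iterate_orbit_eq (hkl : ∀ x, g^[k x] (h (f x)) = g^[l x] (h x)) (n : ℕ) (x : α) :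
    g^[∑ i ∈ Finset.range n, k (f^[i] x)] (h (f^[n] x)) =
      g^[∑ i ∈ Finset.range n, l (f^[i] x)] (h x) := by
  induction n with
  | zero => rfl
  | succ n ih =>
    rw [Finset.sum_range_succ, Finset.sum_range_succ, iterate_add_apply, iterate_succ_apply',
      hkl, ← iterate_add_apply, add_comm, iterate_add_apply, ih, ← iterate_add_apply, add_comm]

lemma TailEquiv.map (hkl : ∀ x, g^[k x] (h (f x)) = g^[l x] (h x)) {x y : α}
    (hxy : TailEquiv f x y) : TailEquiv g (h x) (h y) := by
  have key : ∀ n x, TailEquiv g (h (f^[n] x)) (h x) := fun n x =>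
    ⟨_, _, iterate_orbit_eq hkl n x⟩
  obtain ⟨a, b, hab⟩ := hxy
  have h1 := key a x
  rw [hab] at h1
  exact h1.symm.trans (key b y)

end Cocycle

/-- Tail equivalence classes containing a periodic point; these correspond to the periodic
orbits. -/
abbrev PerClass (f : α → α) : Type _ :=
  {E : Quotient (tailSetoid f) // ∃ x ∈ periodicPts f, Quotient.mk (tailSetoid f) x = E}

/-- The class of a periodic point. -/
def perClass {f : α → α} (x : α) (hx : x ∈ periodicPts f) : PerClass f :=
  ⟨Quotient.mk (tailSetoid f) x, x, hx, rfl⟩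

/-- A periodic point in the class. -/
noncomputable def perRep {f : α → α} (E : PerClass f) : α := E.2.choose

lemma perRep_mem {f : α → α} (E : PerClass f) : perRep E ∈ periodicPts f := E.2.choose_spec.1

lemma perClass_perRep {f : α → α} (E : PerClass f) : perClass (perRep E) (perRep_mem E) = E :=
  Subtype.ext E.2.choose_spec.2

lemma perClass_eq_iff {f : α → α} {x y : α} (hx : x ∈ periodicPts f) (hy : y ∈ periodicPts f) :
    perClass x hx = perClass y hy ↔ TailEquiv f x y :=
  Subtype.ext_iff.trans Quotient.eq

/-- The period of a class. -/
noncomputable def perLen {f : α → α} (E : PerClass f) : ℕ := minimalPeriod f (perRep E)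

lemma perLen_pos {f : α → α} (E : PerClass f) : 0 < perLen E :=
  minimalPeriod_pos_of_mem_periodicPts (perRep_mem E)

/-- Points with a period, indexed by that period. -/
abbrev PerPt (f : α → α) : Type _ := Σ n : ℕ, {x : α // f^[n + 1] x = x}

/-- The points in the `m`-fold traversal of the periodic orbit `E`. -/
noncomputable def orbitPt (f : α → α) (e : Σ e : PerClass f × ℕ, Fin (perLen e.1)) : PerPt f :=
  ⟨perLen e.1.1 * (e.1.2 + 1) - 1, f^[e.2] (perRep e.1.1), by
    rw [Nat.sub_add_cancel (Nat.mul_pos (perLen_pos _) (Nat.succ_pos _))]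
    exact (((isPeriodicPt_minimalPeriod f (perRep e.1.1)).mul_const _).apply_iterate _).eq⟩

lemma orbitPt_fst (f : α → α) (e : Σ e : PerClass f × ℕ, Fin (perLen e.1)) :
    (orbitPt f e).1 + 1 = perLen e.1.1 * (e.1.2 + 1) :=
  Nat.sub_add_cancel (Nat.mul_pos (perLen_pos _) (Nat.succ_pos _))

lemma PerPt.ext {f : α → α} {a b : PerPt f} (h1 : a.1 + 1 = b.1 + 1) (h2 : a.2.1 = b.2.1) :
    a = b := by
  obtain ⟨n, x, hx⟩ := a
  obtain ⟨m, y, hy⟩ := b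
  obtain rfl : n = m := by simpa using h1
  obtain rfl : x = y := h2
  rfl

lemma orbitPt_bijective (f : α → α) : Bijective (orbitPt f) := by
  constructor
  · rintro ⟨⟨E, m⟩, i⟩ ⟨⟨E', m'⟩, i'⟩ hee
    have h1 : f^[i] (perRep E) = f^[i'] (perRep E') := congrArg (fun a => a.2.1) hee
    have h2 := congrArg (fun a => a.1 + 1) hee
    simp only [orbitPt_fst] at h2
    obtain rfl : E = E' := by
      rw [← perClass_perRep E, ← perClass_perRep E', perClass_eq_iff]
      exact ⟨_, _, h1⟩
    obtain rfl : m = m' := by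
      simpa using Nat.eq_of_mul_eq_mul_left (perLen_pos E) h2
    obtain rfl : i = i' :=
      Fin.ext ((iterate_eq_iterate_iff_of_lt_minimalPeriod i.2 i'.2).1 h1)
    rfl
  · rintro ⟨n, x, hx⟩
    have hx' : x ∈ periodicPts f := mk_mem_periodicPts (Nat.succ_pos n) hx
    set E := perClass x hx' with hE
    have ht : TailEquiv f (perRep E) x :=
      (perClass_eq_iff (perRep_mem E) hx').1 (perClass_perRep E)
    obtain ⟨i, hi, hix⟩ := ht.exists_lt_iterate_eq (perRep_mem E) hx'
    have hdvd : perLen E ∣ n + 1 := by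
      rw [perLen, ht.minimalPeriod_eq (perRep_mem E) hx']
      exact IsPeriodicPt.minimalPeriod_dvd hx
    obtain ⟨c, hc⟩ := hdvd
    obtain ⟨m, rfl⟩ : ∃ m, c = m + 1 := Nat.exists_eq_succ_of_ne_zero (by
      rintro rfl
      simp at hc)
    refine ⟨⟨(E, m), ⟨i, hi⟩⟩, PerPt.ext ?_ hix⟩
    rw [orbitPt_fst]
    exact hc.symm

lemma sum_range_mul_of_isPeriodicPt {f : α → α} {p : ℕ} {x : α} (hx : IsPeriodicPt f p x)
    (φ : α → ℤ) (m : ℕ) :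
    ∑ i ∈ Finset.range (p * m), φ (f^[i] x) = m * ∑ i ∈ Finset.range p, φ (f^[i] x) := by
  induction m with
  | zero => simp
  | succ m ih =>
    rw [mul_add_one, Finset.sum_range_add, ih]
    have : ∀ i, f^[p * m + i] x = f^[i] x := fun i => by
      rw [add_comm, iterate_add_apply, (hx.mul_const m).eq]
    simp only [this]
    push_cast
    ring

lemma sum_range_iterate_of_isPeriodicPt {f : α → α} {n : ℕ} {x : α} (hn : IsPeriodicPt f n x)
    (φ : α → ℤ) (j : ℕ) :
    ∑ i ∈ Finset.range n, φ (f^[i] (f^[j] x)) = ∑ i ∈ Finset.range n, φ (f^[i] x) := by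
  induction j with
  | zero => rfl
  | succ j ih =>
    rw [← ih]
    have h1 : ∀ i, f^[i] (f^[j + 1] x) = f^[i + 1] (f^[j] x) := fun i => by
      rw [← iterate_add_apply, ← iterate_add_apply]
      congr 1
      ring
    simp only [h1]
    have h2 := Finset.sum_range_succ (fun i => φ (f^[i] (f^[j] x))) n
    rw [Finset.sum_range_succ'] at h2
    have h3 : f^[n] (f^[j] x) = f^[j] x := (hn.apply_iterate j).eq
    simp only [h3, iterate_zero, id] at h2
    linarith

/-- The summand of the logarithm of a dynamical zeta function. -/
noncomputable def zetaTerm (f : α → α) (φ : α → ℤ) (s : ℂ) (a : PerPt f) : ℂ :=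
  1 / ((a.1 : ℂ) + 1) *
    Complex.exp (-s * ((∑ i ∈ Finset.range (a.1 + 1), φ (f^[i] a.2.1) : ℤ) : ℂ))

/-- The contribution of the `(m + 1)`-fold traversal of a periodic orbit of weight `b E`. -/
noncomputable def orbitTerm {ι : Type*} (b : ι → ℤ) (s : ℂ) (e : ι × ℕ) : ℂ :=
  1 / ((e.2 : ℂ) + 1) * Complex.exp (-s * (((e.2 + 1 : ℕ) * b e.1 : ℤ) : ℂ))

lemma zetaTerm_orbitPt {f : α → α} {φ : α → ℤ} {b : PerClass f → ℤ}
    (hb : ∀ E, b E = ∑ i ∈ Finset.range (perLen E), φ (f^[i] (perRep E))) (s : ℂ)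
    (e : Σ e : PerClass f × ℕ, Fin (perLen e.1)) :
    zetaTerm f φ s (orbitPt f e) = orbitTerm b s e.1 / (perLen e.1.1 : ℂ) := by
  have hp : IsPeriodicPt f (perLen e.1.1) (perRep e.1.1) := isPeriodicPt_minimalPeriod _ _
  have h1 : (((orbitPt f e).1 : ℂ) + 1) = (perLen e.1.1 : ℂ) * ((e.1.2 : ℂ) + 1) := by
    exact_mod_cast congrArg (Nat.cast : ℕ → ℂ) (orbitPt_fst f e)
  have h2 : (∑ i ∈ Finset.range ((orbitPt f e).1 + 1), φ (f^[i] (orbitPt f e).2.1)) =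
      (e.1.2 + 1 : ℕ) * b e.1.1 := by
    change ∑ i ∈ Finset.range ((orbitPt f e).1 + 1), φ (f^[i] (f^[e.2] (perRep e.1.1))) = _
    rw [orbitPt_fst, hb, sum_range_iterate_of_isPeriodicPt (hp.mul_const _),
      sum_range_mul_of_isPeriodicPt hp]
  rw [zetaTerm, orbitTerm, h1, h2, one_div, one_div, mul_inv]
  ring

lemma summable_sigma_fin_div_iff {ι : Type*} {p : ι → ℕ} (hp : ∀ i, 0 < p i) (G : ι → ℂ)
    :
    Summable (fun e : Σ i, Fin (p i) => G e.1 / (p e.1 : ℂ)) ↔ Summable G := by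
  rw [← summable_norm_iff, ← summable_norm_iff (f := G),
    summable_sigma_of_nonneg fun _ => norm_nonneg _]
  have h1 : ∀ i, ∑' _ : Fin (p i), ‖G i / (p i : ℂ)‖ = ‖G i‖ := fun i => by
    have : (p i : ℝ) ≠ 0 := by exact_mod_cast (hp i).ne'
    rw [tsum_fintype]
    simp
    field_simp
  simp only [h1]
  exact ⟨fun h => h.2, fun h => ⟨fun _ => (hasSum_fintype _).summable, h⟩⟩

lemma tsum_sigma_fin_div {ι : Type*} {p : ι → ℕ} (hp : ∀ i, 0 < p i) (G : ι → ℂ)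
    (hG : Summable G) :
    ∑' e : Σ i, Fin (p i), G e.1 / (p e.1 : ℂ) = ∑' i, G i := by
  rw [((summable_sigma_fin_div_iff hp G).2 hG).tsum_sigma]
  refine tsum_congr fun i => ?_
  have : (p i : ℂ) ≠ 0 := by exact_mod_cast (hp i).ne'
  rw [tsum_fintype]
  simp
  field_simp

lemma summable_zetaTerm_iff {f : α → α} {φ : α → ℤ} {b : PerClass f → ℤ}
    (hb : ∀ E, b E = ∑ i ∈ Finset.range (perLen E), φ (f^[i] (perRep E))) (s : ℂ) :
    Summable (zetaTerm f φ s) ↔ Summable (orbitTerm b s) := by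
  rw [← (Equiv.ofBijective _ (orbitPt_bijective f)).summable_iff,
    ← summable_sigma_fin_div_iff (fun e : PerClass f × ℕ => perLen_pos e.1)]
  exact summable_congr fun e => zetaTerm_orbitPt hb s e

lemma tsum_zetaTerm {f : α → α} {φ : α → ℤ} {b : PerClass f → ℤ}
    (hb : ∀ E, b E = ∑ i ∈ Finset.range (perLen E), φ (f^[i] (perRep E))) (s : ℂ)
    (hs : Summable (orbitTerm b s)) :
    ∑' a, zetaTerm f φ s a = ∑' e, orbitTerm b s e := by
  rw [← (Equiv.ofBijective _ (orbitPt_bijective f)).tsum_eq,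
    ← tsum_sigma_fin_div (fun e : PerClass f × ℕ => perLen_pos e.1) _ hs]
  exact tsum_congr fun e => zetaTerm_orbitPt hb s e

end TailEquivalence

section ShiftSpace

open Function Filter Topology

lemma shift_iterate_apply (A : Matrix (Fin N) (Fin N) ℤ) (n : ℕ) (x : Space A) (i : ℕ) :
    ((shift A)^[n] x).1 i = x.1 (i + n) := by
  induction n generalizing x with
  | zero => rfl
  | succ n ih =>
    rw [iterate_succ_apply, ih]
    change x.1 (i + n + 1) = _
    rw [add_assoc]

lemma continuous_shift_iterate (A : Matrix (Fin N) (Fin N) ℤ) (n : ℕ) :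
    Continuous (shift A)^[n] := (continuous_shift A).iterate n

lemma eventually_nhds_eq {α : Type*} [TopologicalSpace α] [DiscreteTopology α] (a : α) :
    ∀ᶠ b in 𝓝 a, b = a := by simp

lemma Space.ext {A : Matrix (Fin N) (Fin N) ℤ} {x y : Space A} (hxy : ∀ i, x.1 i = y.1 i) :
    x = y := Subtype.ext (funext hxy)

/-- Nearby points agree on initial words. -/
lemma eventually_forall_lt_eq {A : Matrix (Fin N) (Fin N) ℤ} (x : Space A) (n : ℕ) :
    ∀ᶠ z in 𝓝 x, ∀ i < n, z.1 i = x.1 i := by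
  have h1 : ∀ i, ∀ᶠ z in 𝓝 x, z.1 i = x.1 i := fun i => by
    have hc : Continuous fun z : Space A => z.1 i :=
      (continuous_apply i).comp continuous_subtype_val
    exact hc.continuousAt.eventually (eventually_nhds_eq (x.1 i))
  exact (Set.finite_Iio n).eventually_all.2 fun i _ => h1 i

/-- Points sharing longer and longer initial words converge. -/
lemma tendsto_of_forall_lt_eq {A : Matrix (Fin N) (Fin N) ℤ} {x : Space A} {w : ℕ → Space A}
    (hw : ∀ n, ∀ i < n, (w n).1 i = x.1 i) : Tendsto w atTop (𝓝 x) := by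
  rw [tendsto_subtype_rng, tendsto_pi_nhds]
  intro i
  refine tendsto_const_nhds.congr' ?_
  filter_upwards [eventually_gt_atTop i] with n hn
  exact (hw n i hn).symm

/-- The shift is locally injective. -/
lemma eventually_eq_of_shift_iterate_eq {A : Matrix (Fin N) (Fin N) ℤ} (x : Space A) (n : ℕ) :
    ∀ᶠ z in 𝓝 x, (shift A)^[n] z = (shift A)^[n] x → z = x := by
  filter_upwards [eventually_forall_lt_eq x n] with z hz heq
  refine Space.ext fun i => ?_
  rcases lt_or_ge i n with hi | hi
  · exact hz i hi
  · have := congrArg (fun y : Space A => y.1 (i - n)) heq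
    simpa only [shift_iterate_apply, Nat.sub_add_cancel hi] using this

lemma le_of_eventually_iterate_eq {A : Matrix (Fin N) (Fin N) ℤ} (x : Space A) [(𝓝[≠] x).NeBot]
    {a b : ℕ} (hab : ∀ᶠ z in 𝓝 x, (shift A)^[a] z = (shift A)^[b] z) : b ≤ a := by
  by_contra! hlt
  have hx := hab.self_of_nhds
  have key : ∀ᶠ z in 𝓝 x, z = x := by
    filter_upwards [hab, eventually_forall_lt_eq x b] with z hz hzx
    refine Space.ext fun i => ?_
    induction i using Nat.strong_induction_on with
    | _ i ih =>
      rcases lt_or_ge i b with hi | hi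
      · exact hzx i hi
      · have h1 := congrArg (fun y : Space A => y.1 (i - b)) hz
        have h2 := congrArg (fun y : Space A => y.1 (i - b)) hx
        simp only [shift_iterate_apply, Nat.sub_add_cancel hi] at h1 h2
        rw [← h1, ← h2]
        exact ih _ (by omega)
  obtain ⟨z, hz, hne⟩ := ((key.filter_mono (nhdsWithin_le_nhds (s := {x}ᶜ))).and self_mem_nhdsWithin).exists
  exact hne hz

/-- Two iterates of the shift agreeing near a non-isolated point are the same iterate. -/
lemma eq_of_eventually_iterate_eq {A : Matrix (Fin N) (Fin N) ℤ} (x : Space A) [(𝓝[≠] x).NeBot]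
    {a b : ℕ} (hab : ∀ᶠ z in 𝓝 x, (shift A)^[a] z = (shift A)^[b] z) : a = b :=
  le_antisymm (le_of_eventually_iterate_eq x (hab.mono fun _ h => h.symm))
    (le_of_eventually_iterate_eq x hab)

/-- The first `m` symbols of `x` followed by `z`. -/
def splice {A : Matrix (Fin N) (Fin N) ℤ} (x : Space A) (m : ℕ) (z : Space A)
    (hz : z.1 0 = x.1 m) : Space A :=
  ⟨fun i => if i < m then x.1 i else z.1 (i - m), fun i => by
    rcases lt_trichotomy (i + 1) m with hi | hi | hi
    · simpa [hi, (Nat.lt_succ_self i).trans hi] using x.2 i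
    · subst hi
      simpa [hz] using x.2 i
    · have h1 : ¬ i < m := by omega
      have h2 : ¬ i + 1 < m := by omega
      have h3 : i + 1 - m = i - m + 1 := by omega
      simpa [h1, h2, h3] using z.2 (i - m)⟩

lemma splice_apply_of_lt {A : Matrix (Fin N) (Fin N) ℤ} {x : Space A} {m : ℕ} {z : Space A}
    (hz : z.1 0 = x.1 m) {i : ℕ} (hi : i < m) : (splice x m z hz).1 i = x.1 i := if_pos hi

lemma shift_iterate_splice {A : Matrix (Fin N) (Fin N) ℤ} {x : Space A} {m : ℕ} {z : Space A}
    (hz : z.1 0 = x.1 m) : (shift A)^[m] (splice x m z hz) = z := by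
  refine Space.ext fun i => ?_
  rw [shift_iterate_apply]
  simp [splice]

/-- A periodic point which is not isolated has a sequence of other points converging to it along
which the dynamics acts as a backward orbit. -/
lemma exists_backward_orbit {A : Matrix (Fin N) (Fin N) ℤ} {x : Space A} [(𝓝[≠] x).NeBot]
    {p : ℕ} (hp : 0 < p) (hx : IsPeriodicPt (shift A) p x) :
    ∃ w : ℕ → Space A, Tendsto w atTop (𝓝 x) ∧ (∀ n, w n ≠ x) ∧
      ∀ n, (shift A)^[p] (w (n + 1)) = w n := by
  obtain ⟨z, hz, hne⟩ := (((eventually_forall_lt_eq x 1).filter_mono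
    (nhdsWithin_le_nhds (s := {x}ᶜ))).and self_mem_nhdsWithin).exists
  have hper : ∀ n i, x.1 (i + p * n) = x.1 i := fun n i => by
    rw [← shift_iterate_apply, (hx.mul_const n).eq]
  have hz' : ∀ n, z.1 0 = x.1 (p * n) := fun n => by
    rw [hz 0 one_pos, ← hper n, zero_add]
  refine ⟨fun n => splice x (p * n) z (hz' n), tendsto_of_forall_lt_eq fun n i hi =>
    splice_apply_of_lt _ (hi.trans_le (Nat.le_mul_of_pos_left n hp)), fun n heq => hne ?_,
    fun n => Space.ext fun i => ?_⟩
  · have h1 := congrArg (shift A)^[p * n] heq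
    rwa [shift_iterate_splice, (hx.mul_const n).eq] at h1
  · rw [shift_iterate_apply]
    have h1 := hper 1 i
    rw [mul_one] at h1
    have h2 : i + p < p * (n + 1) ↔ i < p * n := by rw [mul_add_one]; omega
    have h3 : i + p - p * (n + 1) = i - p * n := by rw [mul_add_one]; omega
    simp only [splice, h2, h3, h1]

/-- An orbit of an iterate of the shift staying close to a fixed point is that fixed point. -/
lemma eventually_eq_of_tendsto_of_iterate_eq {B : Matrix (Fin M) (Fin M) ℤ} {y : Space B}
    {d : ℕ} (hy : (shift B)^[d] y = y) {v : ℕ → Space B} (hv : Tendsto v atTop (𝓝 y))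
    (hvd : ∀ᶠ n in atTop, (shift B)^[d] (v n) = v (n + 1)) : ∀ᶠ n in atTop, v n = y := by
  rcases Nat.eq_zero_or_pos d with rfl | hd
  · obtain ⟨n₀, hn₀⟩ := eventually_atTop.1 hvd
    have hconst : ∀ n ≥ n₀, v n = v n₀ := fun n hn => by
      induction n, hn using Nat.le_induction with
      | base => rfl
      | succ n hn ih => rw [← ih]; exact (hn₀ n hn).symm
    have h1 : v n₀ = y := tendsto_nhds_unique (tendsto_const_nhds.congr'
      (by filter_upwards [eventually_ge_atTop n₀] with n hn using (hconst n hn).symm)) hv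
    filter_upwards [eventually_ge_atTop n₀] with n hn
    rw [hconst n hn, h1]
  · obtain ⟨n₀, hn₀⟩ := eventually_atTop.1 (hvd.and (hv.eventually (eventually_forall_lt_eq y d)))
    filter_upwards [eventually_ge_atTop n₀] with n hn
    refine Space.ext fun i => ?_
    induction i using Nat.strong_induction_on generalizing n with
    | _ i ih =>
      rcases lt_or_ge i d with hi | hi
      · exact (hn₀ n hn).2 i hi
      · have h1 := congrArg (fun u : Space B => u.1 (i - d)) (hn₀ n hn).1
        have h2 := congrArg (fun u : Space B => u.1 (i - d)) hy
        simp only [shift_iterate_apply, Nat.sub_add_cancel hi] at h1 h2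
        rw [h1, h2]
        exact ih _ (by omega) _ (hn.trans (Nat.le_succ n))

end ShiftSpace

section OrbitEquivalence

open Function Filter Topology

variable {A : Matrix (Fin N) (Fin N) ℤ} {B : Matrix (Fin M) (Fin M) ℤ} {h : Space A ≃ₜ Space B}
  {k1 l1 : C(Space A, ℕ)} {k2 l2 : C(Space B, ℕ)}

lemma eventually_birkN_eq (k : C(Space A, ℕ)) (n : ℕ) (x : Space A) :
    ∀ᶠ z in 𝓝 x, birkN A k n z = birkN A k n x := by
  have hc : Continuous (birkN A k n) :=
    continuous_finsetSum _ fun i _ => k.continuous.comp (continuous_shift_iterate A i)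
  exact hc.continuousAt.eventually (eventually_nhds_eq _)

/-- A continuous orbit equivalence preserves the time direction along periodic orbits. -/
lemma birkN_lt_birkN {x : Space A} [(𝓝[≠] x).NeBot]
    (hkl : ∀ x, (shift B)^[k1 x] (h (shift A x)) = (shift B)^[l1 x] (h x))
    {p : ℕ} (hp : 0 < p) (hx : IsPeriodicPt (shift A) p x) :
    birkN A k1 p x < birkN A l1 p x := by
  by_contra! hle
  obtain ⟨w, hw, hne, hstep⟩ := exists_backward_orbit hp hx
  set K := birkN A k1 p x
  set L := birkN A l1 p x
  obtain ⟨d, hd⟩ := Nat.exists_eq_add_of_le' hle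
  have hcoc := iterate_orbit_eq (f := shift A) (g := shift B) (h := h) hkl p
  have hfix : (shift B)^[d] ((shift B)^[L] (h x)) = (shift B)^[L] (h x) := by
    have h1 := hcoc x
    rw [hx.eq] at h1
    rw [← iterate_add_apply, ← hd]
    exact h1
  have hhw : Tendsto (fun n => h (w n)) atTop (𝓝 (h x)) := (h.continuous.tendsto x).comp hw
  have hev : ∀ᶠ n in atTop, (shift B)^[L] (h (w n)) = (shift B)^[L] (h x) := by
    refine eventually_eq_of_tendsto_of_iterate_eq hfix
      (((continuous_shift_iterate B L).tendsto _).comp hhw) ?_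
    have hw1 := (tendsto_add_atTop_iff_nat 1).2 hw
    filter_upwards [hw1.eventually (eventually_birkN_eq k1 p x),
      hw1.eventually (eventually_birkN_eq l1 p x)] with n hk hl
    have h1 := hcoc (w (n + 1))
    rw [hstep] at h1
    change (shift B)^[birkN A k1 p (w (n + 1))] _ = (shift B)^[birkN A l1 p (w (n + 1))] _ at h1
    rw [hk, hl] at h1
    change (shift B)^[K] _ = _ at h1
    rw [← iterate_add_apply, ← hd, h1]
  obtain ⟨n, h1, h2⟩ :=
    (hev.and (hhw.eventually (eventually_eq_of_shift_iterate_eq (h x) L))).exists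
  exact hne n (h.injective (h2 h1))

/-- The lags `l₁ - k₁` and `l₂ - k₂` are inverse to each other along a periodic orbit. -/
lemma period_eq_birkN_sub {x : Space A} [(𝓝[≠] x).NeBot] (horb : OrbitEqFns A B h k1 l1 k2 l2)
    {p : ℕ} (hx : IsPeriodicPt (shift A) p x) :
    (p : ℤ) = (birkN B l2 (birkN A l1 p x) (h x) - birkN B k2 (birkN A l1 p x) (h x) : ℤ) -
      (birkN B l2 (birkN A k1 p x) (h x) - birkN B k2 (birkN A k1 p x) (h x) : ℤ) := by
  set K := birkN A k1 p x with hK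
  set L := birkN A l1 p x with hL
  have hcoc := iterate_orbit_eq (f := shift A) (g := shift B) (h := h) horb.1 p
  have hcoc' := iterate_orbit_eq (f := shift B) (g := shift A) (h := h.symm) horb.2
  have hz1 : Tendsto (fun z => h z) (𝓝 x) (𝓝 (h x)) := h.continuous.tendsto x
  have hz2 : Tendsto (fun z => h ((shift A)^[p] z)) (𝓝 x) (𝓝 (h x)) := by
    have h1 := (h.continuous.comp (continuous_shift_iterate A p)).tendsto x
    simp only [comp_apply, hx.eq] at h1
    exact h1
  have key : birkN B k2 L (h x) + (birkN B l2 K (h x) + p) =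
      birkN B k2 K (h x) + birkN B l2 L (h x) := by
    refine eq_of_eventually_iterate_eq x ?_
    filter_upwards [eventually_birkN_eq k1 p x, eventually_birkN_eq l1 p x,
      hz1.eventually (eventually_birkN_eq k2 L (h x)),
      hz1.eventually (eventually_birkN_eq l2 L (h x)),
      hz2.eventually (eventually_birkN_eq k2 K (h x)),
      hz2.eventually (eventually_birkN_eq l2 K (h x))] with z e1 e2 e3 e4 e5 e6
    have h1 : (shift B)^[birkN A k1 p z] (h ((shift A)^[p] z)) =
      (shift B)^[birkN A l1 p z] (h z) := hcoc z
    have h2 : (shift A)^[birkN B k2 L (h z)] (h.symm ((shift B)^[L] (h z))) =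
      (shift A)^[birkN B l2 L (h z)] (h.symm (h z)) := hcoc' L (h z)
    have h3 : (shift A)^[birkN B k2 K (h ((shift A)^[p] z))]
        (h.symm ((shift B)^[K] (h ((shift A)^[p] z)))) =
      (shift A)^[birkN B l2 K (h ((shift A)^[p] z))] (h.symm (h ((shift A)^[p] z))) :=
      hcoc' K _
    rw [e1, e2, ← hK, ← hL] at h1
    rw [e3, e4, h.symm_apply_apply] at h2
    rw [e5, e6, h.symm_apply_apply, h1, ← iterate_add_apply] at h3
    rw [iterate_add_apply, ← h3, iterate_add_apply, ← h2, ← iterate_add_apply,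
      ← iterate_add_apply, add_comm]
  have := congrArg (Nat.cast : ℕ → ℤ) key
  push_cast at this
  linarith

/-- A continuous orbit equivalence sends a periodic orbit to an orbit whose period is the total
lag along the given one. -/
lemma exists_periodic_birk_eq (hpA : ∀ x : Space A, (𝓝[≠] x).NeBot)
    (horb : OrbitEqFns A B h k1 l1 k2 l2) {x : Space A} (hx : x ∈ periodicPts (shift A)) :
    ∃ y ∈ periodicPts (shift B), TailEquiv (shift B) (h x) y ∧
      birk A (fun x => (l1 x : ℤ) - k1 x) (minimalPeriod (shift A) x) x =
        minimalPeriod (shift B) y := by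
  have := hpA x
  set p := minimalPeriod (shift A) x
  have hp : 0 < p := minimalPeriod_pos_of_mem_periodicPts hx
  have hxp : IsPeriodicPt (shift A) p x := isPeriodicPt_minimalPeriod _ _
  have hlt := birkN_lt_birkN horb.1 hp hxp
  have hper := period_eq_birkN_sub horb hxp
  have hcoc : (shift B)^[birkN A k1 p x] (h ((shift A)^[p] x)) =
    (shift B)^[birkN A l1 p x] (h x) := iterate_orbit_eq horb.1 p x
  have hbirk : birk A (fun x => (l1 x : ℤ) - k1 x) p x = birkN A l1 p x - birkN A k1 p x := by
    simp [birk, birkN, Finset.sum_sub_distrib]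
  rw [hxp.eq] at hcoc
  rw [hbirk]
  set K := birkN A k1 p x
  set L := birkN A l1 p x
  obtain ⟨d, hd⟩ := Nat.exists_eq_add_of_lt hlt
  set y := (shift B)^[K] (h x) with hy
  have hyd : IsPeriodicPt (shift B) (d + 1) y := by
    rw [IsPeriodicPt, IsFixedPt, hy, ← iterate_add_apply,
      show d + 1 + K = L by omega, ← hcoc]
  have hyp : y ∈ periodicPts (shift B) := mk_mem_periodicPts (Nat.succ_pos d) hyd
  have ht : TailEquiv (shift B) y (h x) := tailEquiv_iterate _ _ _
  refine ⟨y, hyp, ht.symm, ?_⟩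
  set q := minimalPeriod (shift B) y
  have hyq : IsPeriodicPt (shift B) q y := isPeriodicPt_minimalPeriod _ _
  obtain ⟨m, hm⟩ := hyd.minimalPeriod_dvd
  change d + 1 = q * m at hm
  have hLK : L = K + q * m := by omega
  set c : Space B → ℤ := fun y => (l2 y : ℤ) - k2 y with hc
  have hsub : ∀ n u, (birkN B l2 n u - birkN B k2 n u : ℤ) = birk B c n u := fun n u => by
    simp [birk, birkN, Finset.sum_sub_distrib, hc]
  have hsplit : birk B c L (h x) = birk B c K (h x) + m * birk B c q y := by
    rw [birk, hLK, Finset.sum_range_add, birk, birk, ← sum_range_mul_of_isPeriodicPt hyq]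
    congr 1
    refine Finset.sum_congr rfl fun i _ => ?_
    rw [hy, ← iterate_add_apply, add_comm]
  rw [hsub, hsub, hsplit, add_sub_cancel_left] at hper
  have ht' : TailEquiv (shift A) (h.symm y) x := by
    have h1 := TailEquiv.map horb.2 ht
    rwa [h.symm_apply_apply] at h1
  have hdvd : (p : ℤ) ∣ birk B c q y := by
    have h1 : (shift A)^[birkN B l2 q y] (h.symm y) = (shift A)^[birkN B k2 q y] (h.symm y) := by
      have h2 : (shift A)^[birkN B k2 q y] (h.symm ((shift B)^[q] y)) =
        (shift A)^[birkN B l2 q y] (h.symm y) := iterate_orbit_eq horb.2 q y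
      rw [hyq.eq] at h2
      exact h2.symm
    rw [← hsub]
    exact ht'.minimalPeriod_dvd hx h1
  obtain ⟨e, he⟩ := hdvd
  have hme : (m : ℤ) * e = 1 := by
    have hp0 : (p : ℤ) ≠ 0 := by exact_mod_cast hp.ne'
    refine mul_left_cancel₀ hp0 ?_
    rw [mul_one]
    nth_rw 2 [hper]
    rw [he]
    ring
  have hm1 : m = 1 := by
    have := Int.isUnit_iff_natAbs_eq.1 (IsUnit.of_mul_eq_one _ hme)
    simpa using this
  rw [hLK, hm1]
  push_cast
  ring

end OrbitEquivalence

section Perfect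

open Function Filter Topology

variable {A : Matrix (Fin N) (Fin N) ℤ}

/-- Prepending an admissible symbol. -/
def consSymbol (a : Fin N) (x : Space A) (hax : A a (x.1 0) = 1) : Space A :=
  ⟨fun i => Nat.casesOn i a x.1, fun i => by
    cases i with
    | zero => exact hax
    | succ i => exact x.2 i⟩

lemma shift_consSymbol (a : Fin N) (x : Space A) (hax : A a (x.1 0) = 1) :
    shift A (consSymbol a x hax) = x := rfl

lemma exists_apply_eq_one_right (hirr : IsIrreducible A) (h01 : IsZeroOne A) (i : Fin N) :
    ∃ j, A i j = 1 := by
  obtain ⟨m, hm, hne⟩ := hirr i i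
  obtain ⟨m, rfl⟩ := Nat.exists_eq_succ_of_ne_zero hm.ne'
  rw [pow_succ', Matrix.mul_apply] at hne
  obtain ⟨j, -, hj⟩ := Finset.exists_ne_zero_of_sum_ne_zero hne
  exact ⟨j, (h01 i j).resolve_left (left_ne_zero_of_mul hj)⟩

lemma exists_apply_eq_one_left (hirr : IsIrreducible A) (h01 : IsZeroOne A) (j : Fin N) :
    ∃ i, A i j = 1 := by
  obtain ⟨m, hm, hne⟩ := hirr j j
  obtain ⟨m, rfl⟩ := Nat.exists_eq_succ_of_ne_zero hm.ne'
  rw [pow_succ, Matrix.mul_apply] at hne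
  obtain ⟨i, -, hi⟩ := Finset.exists_ne_zero_of_sum_ne_zero hne
  exact ⟨i, (h01 i j).resolve_left (right_ne_zero_of_mul hi)⟩

/-- Some symbol of an irreducible matrix which is not a permutation matrix has two followers. -/
lemma exists_two_followers (hirr : IsIrreducible A) (h01 : IsZeroOne A)
    (hnp : ¬ IsPermutationMatrix A) : ∃ i j j', j ≠ j' ∧ A i j = 1 ∧ A i j' = 1 := by
  by_contra! hno
  choose f hf using exists_apply_eq_one_right hirr h01
  have huniq : ∀ i j, A i j = 1 → f i = j := fun i j hij => by
    by_contra hne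
    exact hno i (f i) j hne (hf i) hij
  have hsurj : Surjective f := fun j => by
    obtain ⟨i, hi⟩ := exists_apply_eq_one_left hirr h01 j
    exact ⟨i, huniq i j hi⟩
  refine hnp ⟨Equiv.ofBijective f ⟨Finite.injective_iff_surjective.2 hsurj, hsurj⟩, fun i j => ?_⟩
  change A i j = if f i = j then 1 else 0
  split_ifs with hij
  · rw [← hij, hf]
  · exact (h01 i j).resolve_right fun h1 => hij (huniq i j h1)

lemma exists_space_apply_zero (hirr : IsIrreducible A) (h01 : IsZeroOne A) (a : Fin N) :
    ∃ x : Space A, x.1 0 = a := by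
  choose f hf using exists_apply_eq_one_right hirr h01
  refine ⟨⟨fun n => f^[n] a, fun n => ?_⟩, rfl⟩
  change A (f^[n] a) (f^[n + 1] a) = 1
  rw [iterate_succ_apply']
  exact hf _

lemma nontrivial_cylinder_of_pow_ne_zero (h01 : IsZeroOne A) {i : Fin N}
    (hi : {x : Space A | x.1 0 = i}.Nontrivial) (m : ℕ) (a : Fin N) (ha : (A ^ m) a i ≠ 0) :
    {x : Space A | x.1 0 = a}.Nontrivial := by
  induction m generalizing a with
  | zero =>
    obtain rfl : a = i := by
      by_contra hne
      exact ha (by rw [pow_zero, Matrix.one_apply_ne hne])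
    exact hi
  | succ m ih =>
    rw [pow_succ', Matrix.mul_apply] at ha
    obtain ⟨b, -, hb⟩ := Finset.exists_ne_zero_of_sum_ne_zero ha
    have hab := (h01 a b).resolve_left (left_ne_zero_of_mul hb)
    obtain ⟨u, hu, v, hv, huv⟩ := ih b (right_ne_zero_of_mul hb)
    refine ⟨consSymbol a u (by rwa [hu]), rfl, consSymbol a v (by rwa [hv]), rfl, fun heq => ?_⟩
    exact huv (congrArg (shift A) heq)

lemma nontrivial_cylinder (hirr : IsIrreducible A) (h01 : IsZeroOne A)
    (hnp : ¬ IsPermutationMatrix A) (a : Fin N) : {x : Space A | x.1 0 = a}.Nontrivial := by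
  obtain ⟨i, j, j', hne, hj, hj'⟩ := exists_two_followers hirr h01 hnp
  obtain ⟨u, hu⟩ := exists_space_apply_zero hirr h01 j
  obtain ⟨v, hv⟩ := exists_space_apply_zero hirr h01 j'
  obtain ⟨m, -, hm⟩ := hirr a i
  refine nontrivial_cylinder_of_pow_ne_zero h01 ?_ m a hm
  refine ⟨consSymbol i u (by rwa [hu]), rfl, consSymbol i v (by rwa [hv]), rfl, fun heq => hne ?_⟩
  rw [← hu, ← hv]
  exact congrArg (fun x => (shift A x).1 0) heq

/-- The shift space of an irreducible matrix which is not a permutation matrix is perfect. -/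
lemma nhdsWithin_compl_singleton_neBot (hirr : IsIrreducible A) (h01 : IsZeroOne A)
    (hnp : ¬ IsPermutationMatrix A) (x : Space A) : (𝓝[≠] x).NeBot := by
  have key : ∀ n, ∃ z : Space A, z.1 0 = x.1 n ∧ z ≠ (shift A)^[n] x := fun n =>
    (nontrivial_cylinder hirr h01 hnp (x.1 n)).exists_ne ((shift A)^[n] x)
  choose z hz hne using key
  have hw : Tendsto (fun n => splice x n (z n) (hz n)) atTop (𝓝 x) :=
    tendsto_of_forall_lt_eq fun n i hi => splice_apply_of_lt _ hi
  refine NeBot.mono (map_neBot (f := atTop) (m := fun n => splice x n (z n) (hz n)))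
    (tendsto_nhdsWithin_iff.2 ⟨hw, Eventually.of_forall fun n heq => hne n ?_⟩)
  rw [← shift_iterate_splice (hz n)]
  exact congrArg _ heq

end Perfect

section Zeta

open Function Topology

lemma zeta_eq_exp_tsum_zetaTerm (A : Matrix (Fin N) (Fin N) ℤ) (φ : Space A → ℤ) (s : ℂ)
    (hs : Summable (zetaTerm (shift A) φ s)) :
    zeta A φ s = Complex.exp (∑' a, zetaTerm (shift A) φ s a) := by
  rw [zeta, hs.tsum_sigma]
  simp only [← tsum_mul_left]
  rfl

lemma zetaOrd_eq_zeta_one (A : Matrix (Fin N) (Fin N) ℤ) (s : ℂ) :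
    zetaOrd A s = zeta A (fun _ => 1) s := by
  rw [zetaOrd, zeta]
  congr 2
  ext n
  have h1 : ∀ x : {x : Space A // (shift A)^[n + 1] x = x},
      birk A (fun _ => 1) (n + 1) x.1 = (n : ℤ) + 1 := fun x => by simp [birk]
  simp only [h1, tsum_const, nsmul_eq_mul]
  push_cast
  ring

/-- A point of period `n` is determined by its first `n` symbols. -/
lemma injective_initialWord (A : Matrix (Fin N) (Fin N) ℤ) (n : ℕ) :
    Injective fun (x : {x : Space A // (shift A)^[n + 1] x = x}) (i : Fin (n + 1)) =>
      x.1.1 i := by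
  intro x y hxy
  have hmod : ∀ (x : {x : Space A // (shift A)^[n + 1] x = x}) i,
      x.1.1 (i % (n + 1)) = x.1.1 i := fun x i => by
    have h1 : (shift A)^[(n + 1) * (i / (n + 1))] x.1 = x.1 :=
      (IsPeriodicPt.mul_const (f := shift A) (x := x.1) x.2 _).eq
    conv_rhs => rw [← Nat.mod_add_div i (n + 1), ← shift_iterate_apply, h1]
  refine Subtype.ext (Space.ext fun i => ?_)
  rw [← hmod x, ← hmod y]
  exact congrFun hxy ⟨i % (n + 1), Nat.mod_lt _ n.succ_pos⟩

instance (A : Matrix (Fin N) (Fin N) ℤ) (n : ℕ) :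
    Finite {x : Space A // (shift A)^[n + 1] x = x} :=
  Finite.of_injective _ (injective_initialWord A n)

lemma card_periodic_le (A : Matrix (Fin N) (Fin N) ℤ) (n : ℕ) :
    Nat.card {x : Space A // (shift A)^[n + 1] x = x} ≤ N ^ (n + 1) := by
  simpa using Nat.card_le_card_of_injective _ (injective_initialWord A n)

/-- The series defining the ordinary zeta function converges absolutely for `Re s > log N`. -/
lemma summable_zetaTerm_one (A : Matrix (Fin N) (Fin N) ℤ) (hN : 1 < N) {s : ℂ}
    (hs : Real.log N < s.re) : Summable (zetaTerm (shift A) (fun _ => 1) s) := by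
  have hN0 : (0 : ℝ) < N := by exact_mod_cast (zero_lt_one.trans hN)
  set r : ℝ := N * Real.exp (-s.re) with hr
  have hr0 : 0 ≤ r := by positivity
  have hr1 : r < 1 := by
    rw [hr, ← Real.exp_log hN0, ← Real.exp_add, Real.exp_lt_one_iff]
    linarith
  have hnorm : ∀ (n : ℕ) (x : {x : Space A // (shift A)^[n + 1] x = x}),
      ‖zetaTerm (shift A) (fun _ => 1) s ⟨n, x⟩‖ =
        1 / ((n : ℝ) + 1) * Real.exp (-s.re) ^ (n + 1) := fun n x => by
    have h1 : ((n : ℂ) + 1) = ((n + 1 : ℝ) : ℂ) := by push_cast; rfl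
    have h2 : (0 : ℝ) ≤ (n : ℝ) + 1 := by positivity
    rw [zetaTerm, norm_mul, Complex.norm_exp, ← Real.exp_nat_mul]
    congr 1
    · rw [norm_div, norm_one, h1, Complex.norm_of_nonneg h2]
    · simp
      ring
  rw [← summable_norm_iff, summable_sigma_of_nonneg fun _ => norm_nonneg _]
  refine ⟨fun n => Summable.of_finite, ?_⟩
  refine Summable.of_nonneg_of_le (fun n => tsum_nonneg fun _ => norm_nonneg _) (fun n => ?_)
    ((summable_nat_add_iff 1).2 (summable_geometric_of_lt_one hr0 hr1))
  simp only [hnorm, tsum_const, nsmul_eq_mul]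
  have hc : (Nat.card {x : Space A // (shift A)^[n + 1] x = x} : ℝ) ≤ (N : ℝ) ^ (n + 1) := by
    exact_mod_cast card_periodic_le A n
  have h1 : 1 / ((n : ℝ) + 1) ≤ 1 := by
    rw [div_le_one (by positivity)]
    linarith [(Nat.cast_nonneg n : (0 : ℝ) ≤ n)]
  rw [hr, mul_pow]
  refine mul_le_mul hc ?_ (by positivity) (by positivity)
  exact mul_le_of_le_one_left (by positivity) h1

/-- The bijection between periodic orbits induced by an orbit equivalence. -/
def perClassEquiv {α β : Type*} {f : α → α} {g : β → β} (h : α ≃ β)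
    (hfg : ∀ x y, TailEquiv f x y ↔ TailEquiv g (h x) (h y))
    (hper : ∀ x ∈ periodicPts f, ∃ y ∈ periodicPts g, TailEquiv g (h x) y)
    (hper' : ∀ y ∈ periodicPts g, ∃ x ∈ periodicPts f, TailEquiv f (h.symm y) x) :
    PerClass f ≃ PerClass g :=
  Equiv.subtypeEquiv (Quotient.congr (ra := tailSetoid f) (rb := tailSetoid g) h hfg) (by
    rintro ⟨z⟩
    constructor
    · rintro ⟨x, hx, hxz⟩
      obtain ⟨y, hy, hxy⟩ := hper x hx
      have h1 : TailEquiv f x z := Quotient.exact hxz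
      exact ⟨y, hy, Quotient.sound (s := tailSetoid g) (hxy.symm.trans ((hfg _ _).1 h1))⟩
    · rintro ⟨y, hy, hyz⟩
      obtain ⟨x, hx, hyx⟩ := hper' y hy
      have h1 : TailEquiv g y (h z) := Quotient.exact hyz
      refine ⟨x, hx, Quotient.sound (s := tailSetoid f) (hyx.symm.trans ((hfg _ _).2 ?_))⟩
      rwa [h.apply_symm_apply])

/-- A continuous orbit equivalence turns the ordinary zeta function of the target into the
dynamical zeta function of the source with the lag as potential. -/
lemma zetaOrd_eq_zeta_lag (A : Matrix (Fin N) (Fin N) ℤ) (B : Matrix (Fin M) (Fin M) ℤ)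
    (hM : 1 < M) (hpA : ∀ x : Space A, (𝓝[≠] x).NeBot) (hpB : ∀ x : Space B, (𝓝[≠] x).NeBot)
    (h : Space A ≃ₜ Space B) (k1 l1 : C(Space A, ℕ)) (k2 l2 : C(Space B, ℕ))
    (horb : OrbitEqFns A B h k1 l1 k2 l2) {s : ℂ} (hs : Real.log M < s.re) :
    zetaOrd B s = zeta A (fun x => (l1 x : ℤ) - (k1 x : ℤ)) s := by
  have horb' : OrbitEqFns B A h.symm k2 l2 k1 l1 := ⟨horb.2, horb.1⟩
  have hAB := fun x hx => exists_periodic_birk_eq hpA horb (x := x) hx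
  have hBA := fun y hy => exists_periodic_birk_eq hpB horb' (x := y) hy
  let e : PerClass (shift A) ≃ PerClass (shift B) := perClassEquiv h.toEquiv
    (fun x y => ⟨TailEquiv.map horb.1, fun hxy => by
      have h1 := TailEquiv.map horb.2 hxy
      simpa using h1⟩)
    (fun x hx => let ⟨y, hy, hxy, _⟩ := hAB x hx; ⟨y, hy, hxy⟩)
    (fun y hy => let ⟨x, hx, hyx, _⟩ := hBA y hy; ⟨x, hx, hyx⟩)
  have hbB : ∀ E : PerClass (shift B), (perLen E : ℤ) =
      ∑ i ∈ Finset.range (perLen E), (fun _ => 1) ((shift B)^[i] (perRep E)) := fun E => by simp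
  have hbA : ∀ E : PerClass (shift A), (perLen (e E) : ℤ) =
      ∑ i ∈ Finset.range (perLen E),
        (fun x => (l1 x : ℤ) - (k1 x : ℤ)) ((shift A)^[i] (perRep E)) := fun E => by
    obtain ⟨y, hy, hxy, heq⟩ := hAB (perRep E) (perRep_mem E)
    refine Eq.trans ?_ heq.symm
    have h1 : e E = perClass y hy := by
      conv_lhs => rw [← perClass_perRep E]
      exact Subtype.ext (Quotient.sound (s := tailSetoid (shift B)) hxy)
    have h2 : TailEquiv (shift B) (perRep (e E)) y :=
      (perClass_eq_iff (perRep_mem _) hy).1 ((perClass_perRep _).trans h1)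
    exact congrArg Nat.cast (h2.minimalPeriod_eq (perRep_mem _) hy)
  have hsB := summable_zetaTerm_one B hM hs
  have hoB := (summable_zetaTerm_iff hbB s).1 hsB
  let e' : PerClass (shift A) × ℕ ≃ PerClass (shift B) × ℕ := e.prodCongr (Equiv.refl ℕ)
  have hoA : Summable (orbitTerm (fun E : PerClass (shift A) => (perLen (e E) : ℤ)) s) :=
    e'.summable_iff.2 hoB
  rw [zetaOrd_eq_zeta_one, zeta_eq_exp_tsum_zetaTerm _ _ _ hsB,
    zeta_eq_exp_tsum_zetaTerm _ _ _ ((summable_zetaTerm_iff hbA s).2 hoA),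
    tsum_zetaTerm hbB s hoB, tsum_zetaTerm hbA s hoA]
  exact congrArg Complex.exp (e'.tsum_eq (orbitTerm (fun E => (perLen E : ℤ)) s)).symm

end Zeta

theorem ordinary_zeta_eq_dynamical_zeta
    {N M : ℕ} (A : Matrix (Fin N) (Fin N) ℤ) (B : Matrix (Fin M) (Fin M) ℤ)
    (hN : 1 < N) (hM : 1 < M) (hA01 : IsZeroOne A) (hB01 : IsZeroOne B)
    (hAirr : IsIrreducible A) (hBirr : IsIrreducible B)
    (hAnp : ¬ IsPermutationMatrix A) (hBnp : ¬ IsPermutationMatrix B)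
    (h : Space A ≃ₜ Space B) (k1 l1 : C(Space A, ℕ)) (k2 l2 : C(Space B, ℕ))
    (horb : OrbitEqFns A B h k1 l1 k2 l2) :
    ∃ h0 : ℝ, ∀ s : ℂ, h0 < s.re →
      zetaOrd A s = zeta B (fun y => (l2 y : ℤ) - (k2 y : ℤ)) s ∧
      zetaOrd B s = zeta A (fun x => (l1 x : ℤ) - (k1 x : ℤ)) s := by
  have hpA := nhdsWithin_compl_singleton_neBot hAirr hA01 hAnp
  have hpB := nhdsWithin_compl_singleton_neBot hBirr hB01 hBnp
  refine ⟨max (Real.log N) (Real.log M), fun s hs => ⟨?_, ?_⟩⟩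
  · exact zetaOrd_eq_zeta_lag B A hN hpB hpA h.symm k2 l2 k1 l1 ⟨horb.2, horb.1⟩
      ((le_max_left _ _).trans_lt hs)
  · exact zetaOrd_eq_zeta_lag A B hM hpA hpB h k1 l1 k2 l2 horb
      ((le_max_right _ _).trans_lt hs)

end OneSidedMarkov
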